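/- arXiv:0902.4679 — 2 statements merged into one kernel-verified Lean document; each statement's English description precedes it below -/
import Mathlib

section
/- For all quaternions p, q, one has |q - p| ≤ σ(q,p) ≤ ω(q,p), where ω(q,p) = sqrt((Re q - Re p)² + (|Im q| + |Im p|)²). -/
local notation "ℍ" => Quaternion ℝ

/-- Convolution (star) product of coefficient sequences. -/
noncomputable def conv (a b : ℕ → ℍ) : ℕ → ℍ := fun n => ∑ k ∈ Finset.range (n+1), a k * b (n-k)

/-- Coefficient sequence of the polynomial `q - p` (right coefficients). -/
noncomputable def binomSeq (p : ℍ) : ℕ → ℍ := fun k => if k = 0 then -p else if k = 1 then 1 else 0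

/-- n-fold star (convolution) power of a coefficient sequence. -/
noncomputable def convPow (a : ℕ → ℍ) : ℕ → ℕ → ℍ
  | 0 => fun k => if k = 0 then 1 else 0
  | n+1 => conv (convPow a n) a

/-- The regular power `(q-p)^{*n}` evaluated at `q`. -/
noncomputable def starPow (p : ℍ) (n : ℕ) (q : ℍ) : ℍ :=
  ∑ k ∈ Finset.range (n+1), q^k * convPow (binomSeq p) n k

noncomputable def omegaDist (q p : ℍ) : ℝ :=
  Real.sqrt ((q.re - p.re)^2 + (‖q.im‖ + ‖p.im‖)^2)

/-- `q` and `p` lie in a common complex line `L_I = ℝ + Iℝ`. -/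
def SameLine (q p : ℍ) : Prop :=
  ∃ I : ℍ, I^2 = -1 ∧ (∃ a b : ℝ, q = (a : ℍ) + b • I) ∧ (∃ a b : ℝ, p = (a : ℍ) + b • I)

open Classical in
noncomputable def sigmaDist (q p : ℍ) : ℝ :=
  if SameLine q p then ‖q - p‖ else omegaDist q p

lemma norm_sub_le_omegaDist (q p : ℍ) : ‖q - p‖ ≤ omegaDist q p := by
  refine Real.le_sqrt_of_sq_le ?_
  have hsq : ‖q - p‖ ^ 2 = (q.re - p.re) ^ 2 + ‖q.im - p.im‖ ^ 2 := by
    simp only [sq, ← Quaternion.normSq_eq_norm_mul_self, Quaternion.normSq_def']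
    simp
    ring
  rw [hsq]
  gcongr
  exact norm_sub_le _ _

theorem norm_le_sigma_le_omega (p q : ℍ) :
    ‖q - p‖ ≤ sigmaDist q p ∧ sigmaDist q p ≤ omegaDist q p := by
  unfold sigmaDist
  split_ifs
  · exact ⟨le_rfl, norm_sub_le_omegaDist q p⟩
  · exact ⟨norm_sub_le_omegaDist q p, le_rfl⟩
end

section
/- Fix p ∈ H. For every q ∈ H and every n ∈ ℕ, |(q-p)^{*n}| ≤ 2 σ(q,p)ⁿ. -/
local notation "ℍ" => Quaternion ℝ

theorem conv_binomSeq_zero (a : ℕ → ℍ) (p : ℍ) : conv a (binomSeq p) 0 = -(a 0 * p) := by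
  simp [conv, binomSeq]

theorem conv_binomSeq_succ (a : ℕ → ℍ) (p : ℍ) (k : ℕ) :
    conv a (binomSeq p) (k + 1) = a k - a (k + 1) * p := by
  have h : ∑ i ∈ Finset.range k, a i * binomSeq p (k + 1 - i) = 0 := by
    refine Finset.sum_eq_zero fun i hi => ?_
    have hi := Finset.mem_range.mp hi
    rw [binomSeq, if_neg (by lia), if_neg (by lia), mul_zero]
  rw [conv, Finset.sum_range_succ, Finset.sum_range_succ, h]
  simp [binomSeq, sub_eq_add_neg]

theorem convPow_binomSeq_eq_zero (p : ℍ) {n k : ℕ} (h : n < k) :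
    convPow (binomSeq p) n k = 0 := by
  induction n generalizing k with
  | zero => simp [convPow, h.ne']
  | succ n ih =>
    obtain ⟨k, rfl⟩ := Nat.exists_eq_succ_of_ne_zero (Nat.ne_zero_of_lt h)
    rw [convPow, Nat.succ_eq_add_one, conv_binomSeq_succ, ih (by lia), ih (by lia)]
    simp

theorem starPow_zero (p q : ℍ) : starPow p 0 q = 1 := by
  simp [starPow, convPow]

theorem starPow_succ (p q : ℍ) (n : ℕ) :
    starPow p (n + 1) q = q * starPow p n q - starPow p n q * p := by
  have h : starPow p n q = ∑ k ∈ Finset.range (n + 2), q ^ k * convPow (binomSeq p) n k := by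
    rw [Finset.sum_range_succ, convPow_binomSeq_eq_zero p n.lt_succ_self, mul_zero, add_zero,
      starPow]
  conv_rhs => rw [sub_eq_add_neg]; arg 2; rw [h, Finset.sum_range_succ', add_mul, Finset.sum_mul]
  simp only [starPow, convPow]
  rw [Finset.sum_range_succ', conv_binomSeq_zero]
  simp only [conv_binomSeq_succ, mul_sub, Finset.sum_sub_distrib, Finset.mul_sum, pow_succ',
    mul_assoc, pow_zero, one_mul]
  abel

theorem SameLine.commute {q p : ℍ} (h : SameLine q p) : Commute q p := by
  obtain ⟨I, -, ⟨a, b, rfl⟩, c, d, rfl⟩ := h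
  have hI (r : ℝ) (x : ℍ) : Commute (r : ℍ) x := Quaternion.coe_commutes r x
  exact (hI a _).add_left (((hI c _).symm).add_right
    (((Commute.refl I).smul_left b).smul_right d))

theorem starPow_eq_pow_of_commute {p q : ℍ} (h : Commute q p) (n : ℕ) :
    starPow p n q = (q - p) ^ n := by
  induction n with
  | zero => rw [starPow_zero, pow_zero]
  | succ n ih =>
    have hp : Commute ((q - p) ^ n) p := (h.sub_left (Commute.refl p)).pow_left n
    rw [starPow_succ, ih, hp.eq, pow_succ', sub_mul]

theorem norm_mul_sub_mul_le (q p x : ℍ) : ‖q * x - x * p‖ ≤ omegaDist q p * ‖x‖ := by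
  have hdecomp : q * x - x * p = (q.re - p.re) • x + (q.im * x - x * p.im) := by
    ext <;> simp <;> ring
  have horth : inner ℝ ((q.re - p.re) • x) (q.im * x - x * p.im) = 0 := by
    rw [real_inner_smul_left, Quaternion.inner_def]
    simp only [Quaternion.re_mul, Quaternion.re_star, Quaternion.imI_star, Quaternion.imJ_star,
      Quaternion.imK_star, Quaternion.re_sub, Quaternion.imI_sub, Quaternion.imJ_sub,
      Quaternion.imK_sub, Quaternion.imI_mul, Quaternion.imJ_mul, Quaternion.imK_mul,
      Quaternion.re_im, Quaternion.imI_im, Quaternion.imJ_im,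
      Quaternion.imK_im]
    ring
  have him : ‖q.im * x - x * p.im‖ ≤ (‖q.im‖ + ‖p.im‖) * ‖x‖ := by
    refine (norm_sub_le _ _).trans_eq ?_
    rw [norm_mul, norm_mul]
    ring
  have hsq := norm_add_sq_eq_norm_sq_add_norm_sq_of_inner_eq_zero _ _ horth
  rw [← hdecomp, norm_smul, Real.norm_eq_abs] at hsq
  refine abs_le_of_sq_le_sq' ?_ (by unfold omegaDist; positivity) |>.2
  rw [mul_pow, omegaDist, Real.sq_sqrt (by positivity)]
  have him2 := mul_self_le_mul_self (norm_nonneg _) him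
  nlinarith [sq_abs (q.re - p.re)]

theorem norm_starPow_le_omegaDist_pow (p q : ℍ) (n : ℕ) :
    ‖starPow p n q‖ ≤ omegaDist q p ^ n := by
  induction n with
  | zero => simp [starPow_zero]
  | succ n ih =>
    rw [starPow_succ, pow_succ']
    exact (norm_mul_sub_mul_le q p _).trans
      (mul_le_mul_of_nonneg_left ih (Real.sqrt_nonneg _))

theorem norm_starPow_le_sigmaDist_pow (p q : ℍ) (n : ℕ) :
    ‖starPow p n q‖ ≤ sigmaDist q p ^ n := by
  unfold sigmaDist
  split_ifs with h
  · rw [starPow_eq_pow_of_commute h.commute, norm_pow]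
  · exact norm_starPow_le_omegaDist_pow p q n

theorem starPow_norm_le (p q : ℍ) (n : ℕ) :
    ‖starPow p n q‖ ≤ 2 * sigmaDist q p ^ n := by
  have h := norm_starPow_le_sigmaDist_pow p q n
  linarith [norm_nonneg (starPow p n q)]
end
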